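/- Assume 𝔨 is simple with negative definite Killing form B_𝔨 and B₂ is negative definite. Assume there exists P₁⁰ ∈ 𝔭₁ such that the centralizer 𝔱 = {Z ∈ 𝔨 : ⁅f₁(Z), P₁⁰⁆ = 0} is an abelian subalgebra of 𝔨, and assume ⁅f₂(𝔨), 𝔭₂⁆ ≠ 0. Then (x, y) satisfies the GO condition if and only if (1 − x)/x = c₂(y − 1)/(c₁ y). -/

import Mathlib

open Module in
theorem aux_diag {V ι : Type*} [AddCommGroup V] [Module ℝ V] [Module.Finite ℝ V]
    (B : LinearMap.BilinForm ℝ V) (hs : ∀ a b, B a b = B b a) (hp : ∀ a, a ≠ 0 → B a a < 0)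
    (f : ι → V →ₗ[ℝ] V) (hf : ∀ i a b, B (f i a) b = B a (f i b))
    (hc : ∀ i j, Commute (f i) (f j)) :
    ⨆ χ : ι → ℝ, ⨅ i, Module.End.eigenspace (f i) (χ i) = ⊤ := by
  let core : InnerProductSpace.Core ℝ V :=
    { inner := fun a b => - B a b
      conj_inner_symm := fun a b => by simp [hs a b]
      re_inner_nonneg := fun a => by
        by_cases h : a = 0
        · simp [h]
        · have := hp a h
          simp only [RCLike.re_to_real]; linarith
      add_left := fun a b c => by simp only [map_add, LinearMap.add_apply]; ring
      smul_left := fun a b r => by simp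
      definite := fun a h => by
        by_contra h0
        have := hp a h0
        linarith }
  letI : NormedAddCommGroup V := core.toNormedAddCommGroup
  letI : InnerProductSpace ℝ V := InnerProductSpace.ofCore core.toCore
  refine LinearMap.IsSymmetric.iSup_iInf_eq_top_of_commute (T := f) ?_ ?_
  · intro i a b
    show - B (f i a) b = - B a (f i b)
    rw [hf]
  · intro i j _
    exact hc i j

theorem aux_key {k : Type*} [LieRing k] [LieAlgebra ℝ k] [Module.Finite ℝ k]
    (hknd : ∀ Z : k, Z ≠ 0 → killingForm ℝ k Z Z < 0)
    (t : Set k) (ht : ∀ a ∈ t, ∀ b ∈ t, ⁅a, b⁆ = 0) (s : Submodule ℝ k)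
    (h : ∀ K : k, ∃ T ∈ t, ⁅T, K⁆ = 0 ∧ K + T ∈ s) : s = ⊤ := by
  have inv : ∀ a b c : k, killingForm ℝ k ⁅a, b⁆ c = - killingForm ℝ k b ⁅a, c⁆ :=
    fun a b c => LieModule.traceForm_apply_lie_apply' ℝ k k a b c
  have sym : ∀ a b : k, killingForm ℝ k a b = killingForm ℝ k b a :=
    fun a b => LieModule.traceForm_comm ℝ k k a b
  let f : t → k →ₗ[ℝ] k := fun T => (LieAlgebra.ad ℝ k T.1) ∘ₗ (LieAlgebra.ad ℝ k T.1)
  have fap : ∀ T a, f T a = ⁅T.1, ⁅T.1, a⁆⁆ := fun T a => rfl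
  have hcm : ∀ i j : t, ∀ a : k, ⁅i.1, ⁅j.1, a⁆⁆ = ⁅j.1, ⁅i.1, a⁆⁆ := by
    intro i j a
    rw [leibniz_lie, ht i.1 i.2 j.1 j.2, zero_lie, zero_add]
  have htop := aux_diag (killingForm ℝ k) sym hknd f
    (by intro i a b; rw [fap, fap, inv, inv, neg_neg])
    (by
      intro i j
      ext a
      show f i (f j a) = f j (f i a)
      simp only [fap]
      rw [hcm i j ⁅j.1, a⁆, hcm i j a, hcm i j ⁅j.1, ⁅i.1, a⁆⁆, hcm i j ⁅i.1, a⁆])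
  let S : Set k := {v | ∃ χ : t → ℝ, ∀ i, f i v = χ i • v}
  have hS : ⊤ ≤ Submodule.span ℝ S := by
    rw [← htop]
    refine iSup_le fun χ v hv => Submodule.subset_span ⟨χ, fun i => ?_⟩
    exact Module.End.mem_eigenspace_iff.1 ((Submodule.mem_iInf _).1 hv i)
  let b := Module.Basis.ofSpan hS
  have hb : ∀ i, b i ∈ S := fun i => Module.Basis.ofSpan_subset hS ⟨i, rfl⟩
  haveI := Module.Finite.finite_basis b
  haveI := Fintype.ofFinite ((linearIndepOn_empty ℝ id).extend (Set.empty_subset S))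
  choose χ hχ using hb
  have good : ∀ K : k, (∀ i, b.repr K i ≠ 0) → K ∈ s := by
    intro K hK
    obtain ⟨T, hT, hTK, hs⟩ := h K
    have h1 : f ⟨T, hT⟩ K = 0 := by rw [fap]; simp [hTK]
    have h2 : ∀ i, χ i ⟨T, hT⟩ = 0 := by
      rw [← b.sum_repr K, map_sum] at h1
      simp only [map_smul, hχ, smul_smul] at h1
      intro i
      have := Fintype.linearIndependent_iff.1 b.linearIndependent _ h1 i
      exact (mul_eq_zero.1 this).resolve_left (hK i)
    have h3 : f ⟨T, hT⟩ = 0 := by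
      refine b.ext fun i => ?_
      rw [hχ, h2]; simp
    have h4 : ∀ a : k, ⁅T, a⁆ = 0 := by
      intro a
      by_contra hne
      have h5 := hknd _ hne
      have h6 : ⁅T, ⁅T, a⁆⁆ = 0 := by
        have := fap ⟨T, hT⟩ a
        rw [h3] at this
        simpa using this.symm
      rw [inv, h6] at h5
      simp at h5
    have h5 : T = 0 := by
      by_contra hne
      have h5 := hknd _ hne
      have : LieAlgebra.ad ℝ k T = 0 := by
        ext a; simpa using h4 a
      rw [killingForm_apply_apply, this] at h5
      simp at h5
    simpa [h5] using hs
  have r1 : ∀ i, b.repr (∑ j, b j) i = 1 := fun i => by simp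
  have h1 : ∑ j, b j ∈ s := good _ fun i => by rw [r1]; norm_num
  rw [eq_top_iff, ← b.span_eq, Submodule.span_le]
  rintro _ ⟨i, rfl⟩
  have h2 : b i + ∑ j, b j ∈ s := good _ fun j => by
    classical
    rw [map_add, Finsupp.add_apply, r1, Module.Basis.repr_self, Finsupp.single_apply]
    split_ifs <;> norm_num
  simpa using s.sub_mem h2 h1

theorem aux_comp {k g : Type*} [LieRing k] [LieAlgebra ℝ k] [LieRing g] [LieAlgebra ℝ g]
    (f : k →ₗ⁅ℝ⁆ g) (Z K : k) (P : g) (l x : ℝ) :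
    ⁅f Z + (l • f K + P), l • f K + x • P⁆ =
      f (l • ⁅Z, K⁆) + ⁅f (x • Z + (l * (x - 1)) • K), P⁆ := by
  have : ⁅P, f K⁆ = - ⁅f K, P⁆ := (lie_skew _ _).symm
  simp only [add_lie, lie_add, smul_lie, lie_smul, lie_self, map_add, map_smul, LieHom.map_lie, this]
  module


/-- Assume `𝔨` is simple with negative definite Killing form and `B₂`
is negative definite.  If some `P₁⁰ ∈ 𝔭₁` has abelian centralizer
`𝔱 = {Z ∈ 𝔨 : ⁅f₁ Z, P₁⁰⁆ = 0}` and `⁅f₂(𝔨), 𝔭₂⁆ ≠ 0`, then `(x, y)` satisfies the GO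
condition if and only if `(1 − x)/x = c₂(y − 1)/(c₁ y)`. -/
theorem statement6
    {k g1 g2 : Type*}
    [LieRing k] [LieAlgebra ℝ k] [Module.Finite ℝ k] [LieAlgebra.IsSemisimple ℝ k]
    [LieRing g1] [LieAlgebra ℝ g1] [Module.Finite ℝ g1] [LieAlgebra.IsSemisimple ℝ g1]
    [LieRing g2] [LieAlgebra ℝ g2] [Module.Finite ℝ g2] [LieAlgebra.IsSemisimple ℝ g2]
    (f1 : k →ₗ⁅ℝ⁆ g1) (f2 : k →ₗ⁅ℝ⁆ g2)
    (hf1 : Function.Injective f1) (hf2 : Function.Injective f2)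
    (c1 c2 : ℝ) (hc1 : 0 < c1) (hc2 : 0 < c2)
    (hB1 : ∀ Z W : k, killingForm ℝ k Z W = c1 * killingForm ℝ g1 (f1 Z) (f1 W))
    (hB2 : ∀ Z W : k, killingForm ℝ k Z W = c2 * killingForm ℝ g2 (f2 Z) (f2 W))
    (p1 : Submodule ℝ g1) (hp1 : ∀ P : g1, P ∈ p1 ↔ ∀ Z : k, killingForm ℝ g1 P (f1 Z) = 0)
    (p2 : Submodule ℝ g2) (hp2 : ∀ P : g2, P ∈ p2 ↔ ∀ Z : k, killingForm ℝ g2 P (f2 Z) = 0)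
    (hsum1 : ∀ a : g1, ∃ Z : k, a - f1 Z ∈ p1)
    (hsum2 : ∀ a : g2, ∃ Z : k, a - f2 Z ∈ p2)
    (hint1 : ∀ Z : k, f1 Z ∈ p1 → Z = 0)
    (hint2 : ∀ Z : k, f2 Z ∈ p2 → Z = 0)
    (hlie1 : ∀ Z : k, ∀ P ∈ p1, ⁅f1 Z, P⁆ ∈ p1)
    (hlie2 : ∀ Z : k, ∀ P ∈ p2, ⁅f2 Z, P⁆ ∈ p2)
    (x y : ℝ) (hx : 0 < x) (hy : 0 < y)
    [LieAlgebra.IsSimple ℝ k]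
    (hknd : ∀ Z : k, Z ≠ 0 → killingForm ℝ k Z Z < 0)
    (hg2nd : ∀ a : g2, a ≠ 0 → killingForm ℝ g2 a a < 0)
    (P10 : g1) (hP10 : P10 ∈ p1)
    (habel : ∀ Z W : k, ⁅f1 Z, P10⁆ = 0 → ⁅f1 W, P10⁆ = 0 → ⁅Z, W⁆ = 0)
    (hne : ∃ (K0 : k), ∃ P2 ∈ p2, ⁅f2 K0, P2⁆ ≠ 0) :
    (∀ (K0 : k), ∀ P1 ∈ p1, ∀ P2 ∈ p2, ∃ Z W : k,
        ⁅f1 Z + (f1 K0 + P1), f1 K0 + x • P1⁆ = f1 W ∧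
        ⁅f2 Z + (-(c2 / c1) • f2 K0 + P2), -(c2 / c1) • f2 K0 + y • P2⁆ = f2 W) ↔ (1 - x) / x = c2 * (y - 1) / (c1 * y) := by
  have hl : 0 < c2 / c1 := div_pos hc2 hc1
  have hrhs : c2 * (y - 1) / (c1 * y) = c2 / c1 * (y - 1) / y := by
    field_simp
  rw [hrhs]
  have e1 : ∀ Z K0 P1, ⁅f1 Z + (f1 K0 + P1), f1 K0 + x • P1⁆ =
      f1 ⁅Z, K0⁆ + ⁅f1 (x • Z + (x - 1) • K0), P1⁆ := by
    intro Z K0 P1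
    have := aux_comp f1 Z K0 P1 1 x
    simpa only [one_smul, one_mul] using this
  have e2 : ∀ Z K0 P2, ⁅f2 Z + (-(c2 / c1) • f2 K0 + P2), -(c2 / c1) • f2 K0 + y • P2⁆ =
      f2 (-(c2 / c1) • ⁅Z, K0⁆) + ⁅f2 (y • Z + (-(c2 / c1) * (y - 1)) • K0), P2⁆ :=
    fun Z K0 P2 => aux_comp f2 Z K0 P2 _ y
  simp only [e1, e2]
  generalize c2 / c1 = l at *
  constructor
  · intro h
    by_contra hab
    obtain ⟨K0, P2, hP2, hK0⟩ := hne
    let s : Submodule ℝ k :=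
      { carrier := {Z | ⁅f2 Z, P2⁆ = 0}
        add_mem' := by
          intro a b ha hb
          simp only [Set.mem_setOf_eq] at *
          rw [map_add, add_lie, ha, hb, add_zero]
        zero_mem' := by simp
        smul_mem' := by
          intro r a ha
          simp only [Set.mem_setOf_eq] at *
          rw [map_smul, smul_lie, ha, smul_zero] }
    have hs : s = ⊤ := by
      refine aux_key hknd {Z | ⁅f1 Z, P10⁆ = 0} (fun a ha b hb => habel a b ha hb) s ?_
      intro K
      obtain ⟨Z, W, h1, h2⟩ := h K P10 hP10 P2 hP2
      have w1 : W - ⁅Z, K⁆ = 0 := hint1 _ (by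
        rw [map_sub, ← h1, add_sub_cancel_left]
        exact hlie1 _ _ hP10)
      have w2 : W - -l • ⁅Z, K⁆ = 0 := hint2 _ (by
        rw [map_sub, ← h2, add_sub_cancel_left]
        exact hlie2 _ _ hP2)
      have w1' := sub_eq_zero.1 w1
      have w2' := sub_eq_zero.1 w2
      rw [← w1'] at h1
      rw [← w2'] at h2
      have h1' := add_eq_left.1 h1
      have h2' := add_eq_left.1 h2
      have hzk : ⁅Z, K⁆ = 0 := by
        have : (1 + l) • ⁅Z, K⁆ = 0 := by
          rw [w1'] at w2'
          rw [add_smul, one_smul]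
          nth_rewrite 1 [w2']
          module
        exact (smul_eq_zero.1 this).resolve_left (by positivity)
      have hd : (1 - x) / x - l * (y - 1) / y ≠ 0 := sub_ne_zero.2 hab
      set d := (1 - x) / x - l * (y - 1) / y with hdd
      refine ⟨(d⁻¹ * x⁻¹) • (x • Z + (x - 1) • K), ?_, ?_, ?_⟩
      · show ⁅f1 _, P10⁆ = 0
        rw [map_smul, smul_lie, h1', smul_zero]
      · simp [hzk]
      · have : K + (d⁻¹ * x⁻¹) • (x • Z + (x - 1) • K) =
            (d⁻¹ * y⁻¹) • (y • Z + (-l * (y - 1)) • K) := by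
          have hk : K = (d⁻¹ * d) • K := by rw [inv_mul_cancel₀ hd, one_smul]
          nth_rewrite 1 [hk]
          simp only [smul_add, smul_smul]
          rw [mul_assoc, inv_mul_cancel₀ hx.ne', mul_assoc d⁻¹ y⁻¹ y, inv_mul_cancel₀ hy.ne',
            add_comm, add_assoc, ← add_smul]
          congr 2
          rw [mul_assoc, mul_assoc, ← mul_add]
          congr 1
          rw [hdd]
          field_simp
          ring
        rw [this]
        show ⁅f2 _, P2⁆ = 0
        rw [map_smul, smul_lie, h2', smul_zero]
    have : K0 ∈ s := hs ▸ Submodule.mem_top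
    exact hK0 this
  · intro h K0 P1 _ P2 _
    refine ⟨((1 - x) / x) • K0, 0, ?_, ?_⟩
    · have : x • ((1 - x) / x) • K0 + (x - 1) • K0 = 0 := by
        rw [smul_smul, ← add_smul, mul_div_cancel₀ _ hx.ne']
        simp
      rw [this]; simp
    · have : y • ((1 - x) / x) • K0 + (-l * (y - 1)) • K0 = 0 := by
        rw [h, smul_smul, ← add_smul, mul_div_cancel₀ _ hy.ne']
        simp
      rw [this]; simp
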